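/- arXiv:2409.02557 — 3 statements merged into one kernel-verified Lean document; each statement's English description precedes it below -/
import Mathlib

section
/- Let T be a complex vector space with a trilinear ternary multiplication that is associative of the first kind. Then for all a, b, c, d, f in T the ternary commutator satisfies the basic identity: the sum, over the five cyclic shifts (a,b,c,d,f), (b,c,d,f,a), (c,d,f,a,b), (d,f,a,b,c), (f,a,b,c,d) of the quintuple of arguments, of the expression [[a,b,c],d,f] + [[a,d,b],f,c] + [[a,f,d],c,b] + [[a,c,f],b,d], is equal to zero. -/
/-- The primitive cube root of unity `ω = exp(2πi/3)`. -/
noncomputable def ω : ℂ := Complex.exp (2 * Real.pi * Complex.I / 3)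

/-- Its complex conjugate `ω̄`. -/
noncomputable def ωb : ℂ := (starRingEnd ℂ) ω

/-- The ternary commutator associated with a ternary multiplication `m`. -/
noncomputable def tcomm {T : Type*} [AddCommGroup T] [Module ℂ T]
    (m : T → T → T → T) (a b c : T) : T :=
  m a b c + ω • m b c a + ωb • m c a b + m c b a + ωb • m b a c + ω • m a c b

/-- One group of four double ternary commutators in the basic identity. -/
noncomputable def bid {T : Type*} [AddCommGroup T] [Module ℂ T]
    (m : T → T → T → T) (a b c d f : T) : T :=
  tcomm m (tcomm m a b c) d f + tcomm m (tcomm m a d b) f c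
    + tcomm m (tcomm m a f d) c b + tcomm m (tcomm m a c f) b d

theorem isPrimitiveRoot_ω : IsPrimitiveRoot ω 3 :=
  Complex.isPrimitiveRoot_exp 3 (by norm_num)

theorem ω_mul_self : ω * ω = -1 - ω := by
  have hsum : 1 + ω + ω ^ 2 = 0 := by
    simpa [Finset.sum_range_succ] using isPrimitiveRoot_ω.geom_sum_eq_zero (by norm_num)
  linear_combination hsum

theorem ωb_eq : ωb = -1 - ω := by
  have hconj : ωb = ω⁻¹ :=
    (Complex.inv_eq_conj (isPrimitiveRoot_ω.norm'_eq_one (by norm_num))).symm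
  have hinv : ω⁻¹ = ω * ω :=
    inv_eq_of_mul_eq_one_right (by rw [← sq, ← pow_succ', isPrimitiveRoot_ω.pow_eq_one])
  rw [hconj, hinv, ω_mul_self]

/-- Expansion of a double ternary commutator, sorted by the power of `ω`, for a multiplication
which is associative of the first kind. -/
theorem tcomm_tcomm {T : Type*} [AddCommGroup T] [Module ℂ T]
    (m : T →ₗ[ℂ] T →ₗ[ℂ] T →ₗ[ℂ] T)
    (hmid : ∀ a b c d f : T, m a (m b c d) f = m (m a b c) d f)
    (hright : ∀ a b c d f : T, m a b (m c d f) = m (m a b c) d f) (a b c d f : T) :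
    tcomm (fun x y z => m x y z) (tcomm (fun x y z => m x y z) a b c) d f =
      (m (m a b c) d f + m (m c b a) d f + m (m d f c) a b + m (m d f b) a c
        + m (m f b c) a d + m (m f a c) b d + m (m f d a) b c + m (m f d c) b a
        + m (m d b c) a f + m (m d a c) b f + m (m c a b) f d + m (m b a c) f d) +
      ω • (m (m b c a) d f + m (m a c b) d f + m (m d f a) b c + m (m d f c) b a
        + m (m f c a) b d + m (m f b a) c d + m (m f d b) c a + m (m f d a) c b
        + m (m d c a) b f + m (m d b a) c f + m (m a b c) f d + m (m c b a) f d) +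
      (-1 - ω) • (m (m c a b) d f + m (m b a c) d f + m (m d f b) c a + m (m d f a) c b
        + m (m f a b) c d + m (m f c b) a d + m (m f d c) a b + m (m f d b) a c
        + m (m d a b) c f + m (m d c b) a f + m (m b c a) f d + m (m a c b) f d) := by
  simp only [tcomm, ωb_eq, map_add, map_smul, LinearMap.add_apply, LinearMap.smul_apply,
    hmid, hright]
  match_scalars <;> grind [ω_mul_self]

set_option maxHeartbeats 1000000 in
/-- for a trilinear ternary multiplication which is associative of the
first kind, the ternary commutator satisfies the basic identity. -/
theorem basic_identity_first_kind {T : Type*} [AddCommGroup T] [Module ℂ T]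
    (m : T →ₗ[ℂ] T →ₗ[ℂ] T →ₗ[ℂ] T)
    (hassoc : ∀ a b c d f : T,
      m (m a b c) d f = m a (m b c d) f ∧ m a (m b c d) f = m a b (m c d f)) :
    ∀ a b c d f : T,
      bid (fun x y z => m x y z) a b c d f
        + bid (fun x y z => m x y z) b c d f a
        + bid (fun x y z => m x y z) c d f a b
        + bid (fun x y z => m x y z) d f a b c
        + bid (fun x y z => m x y z) f a b c d = 0 := by
  intro a b c d f
  have hmid (a b c d f : T) : m a (m b c d) f = m (m a b c) d f := (hassoc a b c d f).1.symm
  have hright (a b c d f : T) : m a b (m c d f) = m (m a b c) d f :=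
    ((hassoc a b c d f).1.trans (hassoc a b c d f).2).symm
  simp only [bid, tcomm_tcomm m hmid hright]
  generalize ω = w
  generalize hp : (fun a b c d f : T => m (m a b c) d f) = p
  have hp' (a b c d f : T) : m (m a b c) d f = p a b c d f := by rw [← hp]
  simp only [hp']
  clear hp hp' hmid hright hassoc m
  module
end

section
/- Let T be a complex vector space with a trilinear ternary multiplication that is associative of the second kind. Then for all a, b, c, d, f in T the ternary commutator satisfies the basic identity: the sum, over the five cyclic shifts (a,b,c,d,f), (b,c,d,f,a), (c,d,f,a,b), (d,f,a,b,c), (f,a,b,c,d) of the quintuple of arguments, of the expression [[a,b,c],d,f] + [[a,d,b],f,c] + [[a,f,d],c,b] + [[a,c,f],b,d], is equal to zero. -/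
theorem ω_pow_three : ω ^ 3 = 1 := by
  rw [ω, ← Complex.exp_nat_mul, ← Complex.exp_two_pi_mul_I]
  congr 1
  push_cast
  ring

theorem ωb_eq_sq : ωb = ω ^ 2 := by
  have hnorm : ω * ωb = 1 := by
    have h : ‖ω‖ = 1 := by
      rw [ω, show (2 * Real.pi * Complex.I / 3 : ℂ) = ((2 * Real.pi / 3 : ℝ) : ℂ) * Complex.I by
        push_cast; ring]
      exact Complex.norm_exp_ofReal_mul_I _
    rw [ωb, Complex.mul_conj, Complex.normSq_eq_norm_sq, h]
    norm_num
  linear_combination ω ^ 2 * hnorm - ωb * ω_pow_three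

theorem one_add_ω_add_ωb : 1 + ω + ωb = 0 := by
  have hne : ω ≠ 1 := by
    intro h
    rw [ω, Complex.exp_eq_one_iff] at h
    obtain ⟨n, hn⟩ := h
    have h3 : (1 : ℂ) = 3 * n := by
      have := Complex.two_pi_I_ne_zero
      apply mul_left_cancel₀ this
      linear_combination 3 * hn
    norm_cast at h3
    omega
  rw [ωb_eq_sq]
  apply mul_left_cancel₀ (sub_ne_zero.mpr hne)
  linear_combination ω_pow_three

/-- The sum of the left-normed words with coefficient 1 in the double ternary commutator
`[[a, b, c], d, f]` of a multiplication which is associative of the second kind. -/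
def tcommTcommOne {T : Type*} [AddCommGroup T] (m : T → T → T → T) (a b c d f : T) : T :=
  m (m a b c) d f + m (m c b a) d f + m (m d f c) a b + m (m d f b) a c
    + m (m f a c) b d + m (m f b c) a d + m (m f d a) b c + m (m f d c) b a
    + m (m d a c) b f + m (m d b c) a f + m (m c a b) f d + m (m b a c) f d

/-- The sum of the left-normed words with coefficient `ω` in the double ternary commutator
`[[a, b, c], d, f]` of a multiplication which is associative of the second kind. -/
def tcommTcommOmega {T : Type*} [AddCommGroup T] (m : T → T → T → T) (a b c d f : T) : T :=
  m (m b c a) d f + m (m a c b) d f + m (m d f a) b c + m (m d f c) b a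
    + m (m f b a) c d + m (m f c a) b d + m (m f d b) c a + m (m f d a) c b
    + m (m d b a) c f + m (m d c a) b f + m (m a b c) f d + m (m c b a) f d

/-- The sum of the left-normed words with coefficient `ωb` in the double ternary commutator
`[[a, b, c], d, f]` of a multiplication which is associative of the second kind. -/
def tcommTcommOmegaBar {T : Type*} [AddCommGroup T] (m : T → T → T → T) (a b c d f : T) : T :=
  m (m c a b) d f + m (m b a c) d f + m (m d f b) c a + m (m d f a) c b
    + m (m f c b) a d + m (m f a b) c d + m (m f d c) a b + m (m f d b) a c
    + m (m d c b) a f + m (m d a b) c f + m (m b c a) f d + m (m a c b) f d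

theorem tcomm_tcomm_eq {T : Type*} [AddCommGroup T] [Module ℂ T]
    (m : T →ₗ[ℂ] T →ₗ[ℂ] T →ₗ[ℂ] T)
    (hassoc : ∀ a b c d f : T,
      m (m a b c) d f = m a (m d c b) f ∧ m a (m d c b) f = m a b (m c d f))
    (a b c d f : T) :
    tcomm (fun x y z => m x y z) (tcomm (fun x y z => m x y z) a b c) d f
      = tcommTcommOne (fun x y z => m x y z) a b c d f
        + ω • tcommTcommOmega (fun x y z => m x y z) a b c d f
        + ωb • tcommTcommOmegaBar (fun x y z => m x y z) a b c d f := by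
  have hmid (a b c d f : T) : m a (m d c b) f = m (m a b c) d f := (hassoc a b c d f).1.symm
  have hright (a b c d f : T) : m a b (m c d f) = m (m a b c) d f :=
    ((hassoc a b c d f).1.trans (hassoc a b c d f).2).symm
  have h₁ : ω * ω = ωb := by rw [ωb_eq_sq]; ring
  have h₂ : ω * ωb = 1 := by rw [ωb_eq_sq]; linear_combination ω_pow_three
  have h₃ : ωb * ω = 1 := by rw [mul_comm, h₂]
  have h₄ : ωb * ωb = ω := by rw [ωb_eq_sq]; linear_combination ω * ω_pow_three
  simp only [tcomm, tcommTcommOne, tcommTcommOmega, tcommTcommOmegaBar, map_add, map_smul,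
    LinearMap.add_apply, LinearMap.smul_apply, smul_add, smul_smul, h₁, h₂, h₃, h₄, one_smul,
    hmid, hright]
  abel

/-- for a trilinear ternary multiplication which is associative of the
second kind, the ternary commutator satisfies the basic identity. -/
theorem basic_identity_second_kind {T : Type*} [AddCommGroup T] [Module ℂ T]
    (m : T →ₗ[ℂ] T →ₗ[ℂ] T →ₗ[ℂ] T)
    (hassoc : ∀ a b c d f : T,
      m (m a b c) d f = m a (m d c b) f ∧ m a (m d c b) f = m a b (m c d f)) :
    ∀ a b c d f : T,
      bid (fun x y z => m x y z) a b c d f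
        + bid (fun x y z => m x y z) b c d f a
        + bid (fun x y z => m x y z) c d f a b
        + bid (fun x y z => m x y z) d f a b c
        + bid (fun x y z => m x y z) f a b c d = 0 := by
  intro a b c d f
  simp only [bid, tcomm_tcomm_eq m hassoc]
  have combine (P Q R : T) (hPQ : P = Q) (hPR : P = R) : P + ω • Q + ωb • R = 0 := by
    rw [← hPQ, ← hPR]
    calc P + ω • P + ωb • P = (1 + ω + ωb) • P := by module
      _ = 0 := by rw [one_add_ω_add_ωb, zero_smul]
  let S (g : T → T → T → T → T → T) (a b c d f : T) : T :=
    g a b c d f + g a d b f c + g a f d c b + g a c f b d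
  let C (g : T → T → T → T → T → T) : T :=
    S g a b c d f + S g b c d f a + S g c d f a b + S g d f a b c + S g f a b c d
  refine Eq.trans ?_ (combine (C (tcommTcommOne fun x y z => m x y z))
    (C (tcommTcommOmega fun x y z => m x y z)) (C (tcommTcommOmegaBar fun x y z => m x y z)) ?_ ?_)
  · simp only [C, S, smul_add]
    abel
  · simp only [C, S, tcommTcommOne, tcommTcommOmega]
    abel
  · simp only [C, S, tcommTcommOne, tcommTcommOmegaBar]
    abel
end

section
/- Let N be a positive integer and regard N-th order three-dimensional complex matrices as families A = (A_{ijk}) with i,j,k ∈ {1,…,N}. The trilinear ternary product defined by (A⊙B⊙C)_{ijk} = Σ_{l,m,n} A_{ilm} B_{nlm} C_{njk} is associative of the second kind: (A⊙B⊙C)⊙D⊙F = A⊙(D⊙C⊙B)⊙F = A⊙B⊙(C⊙D⊙F) for all three-dimensional matrices A, B, C, D, F of order N. -/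
open Finset

/-- Ternary product number 1 (in the sense of Abramov–Kerner–Liivapuu–Shitov) of
three-dimensional complex matrices of order `N`:
`(A ⊙ B ⊙ C)_{ijk} = A i l m * B n l m * C n j k` (summation over `l, m, n`). -/
noncomputable def tprod3 {N : ℕ} (A B C : Fin N → Fin N → Fin N → ℂ) :
    Fin N → Fin N → Fin N → ℂ :=
  fun i j k => ∑ l, ∑ m, ∑ n, A i l m * B n l m * C n j k

/-- The `N × N²` matrix obtained from a three-dimensional matrix of order `N` by merging its last
two indices. -/
def flatten {N : ℕ} (A : Fin N → Fin N → Fin N → ℂ) : Matrix (Fin N) (Fin N × Fin N) ℂ :=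
  Matrix.of fun i p => A i p.1 p.2

theorem flatten_injective {N : ℕ} : Function.Injective (flatten (N := N)) := by
  intro A B h
  funext i j k
  exact congrFun (congrFun h i) (j, k)

theorem flatten_tprod3 {N : ℕ} (A B C : Fin N → Fin N → Fin N → ℂ) :
    flatten (tprod3 A B C) = flatten A * (flatten B).transpose * flatten C := by
  ext i p
  simp only [flatten, tprod3, Matrix.mul_apply, Matrix.of_apply, Matrix.transpose_apply,
    Finset.sum_mul]
  symm
  rw [Finset.sum_comm, Fintype.sum_prod_type]

/-- this ternary product of three-dimensional matrices is associative
of the second kind. -/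
theorem tprod_assoc_second_kind {N : ℕ} (hN : 0 < N)
    (A B C D F : Fin N → Fin N → Fin N → ℂ) :
    tprod3 (tprod3 A B C) D F = tprod3 A (tprod3 D C B) F ∧
    tprod3 A (tprod3 D C B) F = tprod3 A B (tprod3 C D F) := by
  constructor <;> apply flatten_injective <;>
    simp only [flatten_tprod3, Matrix.transpose_mul, Matrix.transpose_transpose, Matrix.mul_assoc]
end
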